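/- arXiv:1907.09975 — 3 statements merged into one kernel-verified Lean document; each statement's English description precedes it below -/
import Mathlib

section
/- For all dotted compositions α and β and every N, the following identity holds in A_N: M_α · M_β = Σ_P sign(P) · M_{Γ(P)}, where the sum runs over all (α,β)-overlapping shuffles P, Γ(P) is the resulting dotted composition of P, and sign(P) = (−1)^{#{(p,q) : α_q and β_p both dotted and g(p) < f(q)}}. -/
open TensorProduct

set_option synthInstance.maxHeartbeats 1000000
set_option maxHeartbeats 1000000

noncomputable section

/-- The ring of polynomials in superspace in `N` variables. -/
abbrev SuperAlg (N : ℕ) : Type :=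
  MvPolynomial (Fin N) ℚ ⊗[ℚ] ExteriorAlgebra ℚ (Fin N → ℚ)

/-- The (bosonic) variable `x_i`. -/
def sx {N : ℕ} (i : Fin N) : SuperAlg N := MvPolynomial.X i ⊗ₜ[ℚ] 1

/-- The (fermionic) variable `θ_i`. -/
def sθ {N : ℕ} (i : Fin N) : SuperAlg N :=
  1 ⊗ₜ[ℚ] ExteriorAlgebra.ι ℚ (Pi.single i 1)

/-- A dotted composition is a list of parts `(a, η)` where `η = true` marks a dotted part,
and undotted parts must be positive. -/
def IsDottedComp (α : List (ℕ × Bool)) : Prop :=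
  ∀ p ∈ α, p.2 = false → 1 ≤ p.1

/-- The monomial quasisymmetric function in superspace `M_α(B)` on the alphabet `B`:
the sum over `i_1 < ⋯ < i_ℓ` in `B` of `θ_{i_1}^{η_1} x_{i_1}^{a_1} ⋯ θ_{i_ℓ}^{η_ℓ} x_{i_ℓ}^{a_ℓ}`
(each strictly increasing tuple being encoded as a subset of `B` of size `ℓ`,
listed in increasing order). -/
def Mqs {N : ℕ} (α : List (ℕ × Bool)) (B : Finset (Fin N)) : SuperAlg N :=
  ∑ S ∈ B.powersetCard α.length,
    (List.zipWith (fun i p => (if p.2 then sθ i else 1) * sx i ^ p.1)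
      (S.sort (· ≤ ·)) α).prod

/-- An `(α,β)`-overlapping shuffle: `r ∈ ℕ` together with strictly increasing maps
`f : Fin ℓ(α) → Fin r` and `g : Fin ℓ(β) → Fin r` whose images cover `Fin r`, such that
no position is hit by both `f` and `g` at a pair of dotted parts. -/
structure OverlapShuffle (α β : List (ℕ × Bool)) where
  r : ℕ
  f : Fin α.length → Fin r
  g : Fin β.length → Fin r
  f_mono : StrictMono f
  g_mono : StrictMono g
  cover : ∀ h : Fin r, (∃ q, f q = h) ∨ (∃ p, g p = h)
  not_both_dotted : ∀ (q : Fin α.length) (p : Fin β.length),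
    f q = g p → ¬((α.get q).2 = true ∧ (β.get p).2 = true)

/-- The dotted composition `Γ(P)` resulting from an overlapping shuffle `P`: its `h`-th part
has value the sum of the values of the parts of `α` and `β` placed at position `h`
(since `f` and `g` are injective there is at most one of each kind), and it is dotted iff
one of these parts is dotted. -/
def OverlapShuffle.comp {α β : List (ℕ × Bool)} (P : OverlapShuffle α β) :
    List (ℕ × Bool) :=
  List.ofFn fun h : Fin P.r =>
    ((∑ q ∈ Finset.univ.filter (fun q => P.f q = h), (α.get q).1)
        + ∑ p ∈ Finset.univ.filter (fun p => P.g p = h), (β.get p).1,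
      decide (∃ q, P.f q = h ∧ (α.get q).2 = true) ||
        decide (∃ p, P.g p = h ∧ (β.get p).2 = true))

/-- The sign of an overlapping shuffle:
`(−1)^{#{(p,q) : β_p and α_q both dotted and g(p) < f(q)}}`. -/
def OverlapShuffle.sign {α β : List (ℕ × Bool)} (P : OverlapShuffle α β) : ℤ :=
  (-1) ^ (Finset.univ.filter (fun pq : Fin β.length × Fin α.length =>
      (β.get pq.1).2 = true ∧ (α.get pq.2).2 = true ∧ P.g pq.1 < P.f pq.2)).card

section OrderedProducts

variable {A : Type*} [Ring A]

/-- The factor `t ^ η * y ^ a` attached to a part `(a, η)`. -/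
def partFactor (t y : A) (p : ℕ × Bool) : A :=
  (if p.2 then t else 1) * y ^ p.1

/-- The superposition of two parts: values add up, and the result is dotted iff one part is. -/
def partAdd (p q : ℕ × Bool) : ℕ × Bool := (p.1 + q.1, p.2 || q.2)

/-- The ordered product of the factors of a tuple of parts. -/
def orderedProd {n : ℕ} (t y : Fin n → A) (p : Fin n → ℕ × Bool) : A :=
  (List.ofFn fun i => partFactor (t i) (y i) (p i)).prod

theorem orderedProd_succ {n : ℕ} (t y : Fin (n + 1) → A) (p : Fin (n + 1) → ℕ × Bool) :
    orderedProd t y p = partFactor (t 0) (y 0) (p 0) *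
      orderedProd (fun i => t i.succ) (fun i => y i.succ) (fun i => p i.succ) := by
  simp [orderedProd, List.ofFn_succ]

theorem partFactor_mul {t y : A} (hty : Commute y t) (ht : t * t = 0) (p q : ℕ × Bool) :
    partFactor t y p * partFactor t y q =
      if p.2 = true ∧ q.2 = true then 0 else partFactor t y (partAdd p q) := by
  obtain ⟨a, η⟩ := p
  obtain ⟨b, ζ⟩ := q
  have h : y ^ a * t = t * y ^ a := (hty.pow_left a).eq
  cases η <;> cases ζ <;> simp only [partFactor, partAdd] <;> simp [pow_add, mul_assoc]
  · rw [← mul_assoc, h, mul_assoc]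
  · rw [← mul_assoc (y ^ a), h, ← mul_assoc, ← mul_assoc, ht]
    simp

theorem partFactor_mul_odd {t y s : A} (hy : Commute y s) (ht : t * s = -(s * t))
    (p : ℕ × Bool) :
    partFactor t y p * s = (-1 : ℤ) ^ (if p.2 = true then 1 else 0) • (s * partFactor t y p) := by
  have h : y ^ p.1 * s = s * y ^ p.1 := (hy.pow_left _).eq
  cases hp : p.2
  · simp [partFactor, hp, h]
  · simp [partFactor, hp, mul_assoc, h]
    rw [← mul_assoc, ht]
    simp [mul_assoc]

theorem orderedProd_mul_odd {n : ℕ} {t y : Fin n → A} {s : A} (hy : ∀ i, Commute (y i) s)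
    (ht : ∀ i, t i * s = -(s * t i)) (p : Fin n → ℕ × Bool) :
    orderedProd t y p * s =
      (-1 : ℤ) ^ (∑ i, if (p i).2 = true then 1 else 0) • (s * orderedProd t y p) := by
  induction n with
  | zero => simp [orderedProd]
  | succ n ih =>
    rw [orderedProd_succ, mul_assoc, ih (fun i => hy i.succ) (fun i => ht i.succ),
      mul_smul_comm, ← mul_assoc, partFactor_mul_odd (hy 0) (ht 0), smul_mul_assoc, smul_smul,
      ← pow_add, Fin.sum_univ_succ, add_comm, mul_assoc]

theorem commute_orderedProd {n : ℕ} {t y : Fin n → A} {z : A} (ht : ∀ i, Commute z (t i))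
    (hy : ∀ i, Commute z (y i)) (p : Fin n → ℕ × Bool) : Commute z (orderedProd t y p) := by
  refine Commute.list_prod_right _ _ fun w hw => ?_
  obtain ⟨i, rfl⟩ := List.mem_ofFn.1 hw
  refine Commute.mul_right ?_ ((hy i).pow_right _)
  split_ifs
  exacts [ht i, Commute.one_right z]

/-- The relations between odd variables `t` and even variables `y`. -/
structure SuperRelations {n : ℕ} (t y : Fin n → A) : Prop where
  sq : ∀ i, t i * t i = 0
  anticomm : ∀ i j, t i * t j = -(t j * t i)
  comm_odd : ∀ i j, Commute (y i) (t j)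
  comm_even : ∀ i j, Commute (y i) (y j)

theorem SuperRelations.comp {m n : ℕ} {t y : Fin n → A} (h : SuperRelations t y)
    (e : Fin m → Fin n) : SuperRelations (fun i => t (e i)) (fun i => y (e i)) :=
  ⟨fun _ => h.sq _, fun _ _ => h.anticomm _ _, fun _ _ => h.comm_odd _ _,
    fun _ _ => h.comm_even _ _⟩

theorem orderedProd_succ_mul {n : ℕ} {t y : Fin (n + 1) → A} (h : SuperRelations t y)
    (p q : Fin (n + 1) → ℕ × Bool) :
    orderedProd t y p * orderedProd t y q =
      (-1 : ℤ) ^ (∑ i : Fin n, if (q 0).2 = true ∧ (p i.succ).2 = true then 1 else 0) •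
        ((partFactor (t 0) (y 0) (p 0) * partFactor (t 0) (y 0) (q 0)) *
          (orderedProd (fun i => t i.succ) (fun i => y i.succ) (fun i => p i.succ) *
            orderedProd (fun i => t i.succ) (fun i => y i.succ) (fun i => q i.succ))) := by
  have key : orderedProd (fun i => t i.succ) (fun i => y i.succ) (fun i => p i.succ) *
      partFactor (t 0) (y 0) (q 0) =
      (-1 : ℤ) ^ (∑ i : Fin n, if (q 0).2 = true ∧ (p i.succ).2 = true then 1 else 0) •
        (partFactor (t 0) (y 0) (q 0) *
          orderedProd (fun i => t i.succ) (fun i => y i.succ) (fun i => p i.succ)) := by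
    have hc := (commute_orderedProd (fun i => h.comm_odd 0 (Fin.succ i))
      (fun i => h.comm_even 0 (Fin.succ i)) (fun i => p i.succ)).pow_left (q 0).1
    cases hq : (q 0).2
    · simpa [partFactor, hq] using hc.eq.symm
    · have ho := orderedProd_mul_odd (s := t 0) (fun i => h.comm_odd (Fin.succ i) 0)
        (fun i => h.anticomm (Fin.succ i) 0) (fun i => p i.succ)
      simp only [partFactor, hq, if_true, true_and]
      rw [← mul_assoc, ho, smul_mul_assoc, mul_assoc, mul_assoc, hc.eq]
  rw [orderedProd_succ t y p, orderedProd_succ t y q, mul_assoc,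
    ← mul_assoc _ (partFactor _ _ (q 0)), key, smul_mul_assoc, mul_smul_comm]
  simp only [mul_assoc]

theorem orderedProd_mul_eq_zero {n : ℕ} {t y : Fin n → A} (h : SuperRelations t y)
    (p q : Fin n → ℕ × Bool) (i : Fin n) (hp : (p i).2 = true) (hq : (q i).2 = true) :
    orderedProd t y p * orderedProd t y q = 0 := by
  induction n with
  | zero => exact i.elim0
  | succ n ih =>
    rw [orderedProd_succ_mul h]
    cases i using Fin.cases with
    | zero => simp [partFactor_mul (h.comm_odd 0 0) (h.sq 0), hp, hq]
    | succ i =>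
      rw [ih (h.comp Fin.succ) (fun i => p i.succ) (fun i => q i.succ) i hp hq]
      simp

theorem orderedProd_mul {n : ℕ} {t y : Fin n → A} (h : SuperRelations t y)
    (p q : Fin n → ℕ × Bool) (hpq : ∀ i, ¬((p i).2 = true ∧ (q i).2 = true)) :
    orderedProd t y p * orderedProd t y q =
      (-1 : ℤ) ^ (∑ j, ∑ i, if (q j).2 = true ∧ (p i).2 = true ∧ j < i then 1 else 0) •
        orderedProd t y (fun i => partAdd (p i) (q i)) := by
  induction n with
  | zero => simp [orderedProd]
  | succ n ih =>
    rw [orderedProd_succ_mul h, partFactor_mul (h.comm_odd 0 0) (h.sq 0), if_neg (hpq 0),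
      ih (h.comp Fin.succ) (fun i => p i.succ) (fun i => q i.succ) (fun i => hpq i.succ),
      mul_smul_comm, smul_smul, ← pow_add,
      orderedProd_succ t y (fun i => partAdd (p i) (q i))]
    congr 2
    simp [Fin.sum_univ_succ, -Finset.sum_boole]

end OrderedProducts

section Pushforward

/-- Placing the parts of a tuple at the positions given by `f`, with `(0, false)` elsewhere. -/
def pushParts {m n : ℕ} (f : Fin m → Fin n) (p : Fin m → ℕ × Bool) (h : Fin n) : ℕ × Bool :=
  (∑ q ∈ Finset.univ.filter (fun q => f q = h), (p q).1,
    decide (∃ q, f q = h ∧ (p q).2 = true))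

theorem pushParts_snd {m n : ℕ} (f : Fin m → Fin n) (p : Fin m → ℕ × Bool) (h : Fin n) :
    (pushParts f p h).2 = true ↔ ∃ q, f q = h ∧ (p q).2 = true := by
  simp [pushParts]

theorem pushParts_apply {m n : ℕ} {f : Fin m → Fin n} (hf : Function.Injective f)
    (p : Fin m → ℕ × Bool) (q : Fin m) : pushParts f p (f q) = p q := by
  simp [pushParts, hf.eq_iff, Finset.filter_eq']

theorem pushParts_of_notMem {m n : ℕ} {f : Fin m → Fin n} (p : Fin m → ℕ × Bool) {h : Fin n}
    (hh : h ∉ Set.range f) : pushParts f p h = (0, false) := by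
  have h' : ∀ q, f q ≠ h := fun q hq => hh ⟨q, hq⟩
  simp [pushParts, h']

theorem List.prod_map_filter_of_eq_one {ι M : Type*} [Monoid M] (F : ι → M) (P : ι → Prop)
    [DecidablePred P] (l : List ι) (hF : ∀ i, ¬P i → F i = 1) :
    ((l.filter P).map F).prod = (l.map F).prod := by
  induction l with
  | nil => rfl
  | cons a l ih => by_cases ha : P a <;> simp [ha, ih, hF]

theorem prod_ofFn_comp_strictMono {M : Type*} [Monoid M] {m n : ℕ} {f : Fin m → Fin n}
    (hf : StrictMono f) (F : Fin n → M) (hF : ∀ h, h ∉ Set.range f → F h = 1) :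
    (List.ofFn fun q => F (f q)).prod = (List.ofFn F).prod := by
  classical
  have hl : (List.finRange n).filter (· ∈ Set.range f) = List.ofFn f := by
    refine List.SortedLT.eq_of_mem_iff ?_ hf.sortedLT_ofFn (by simp)
    exact ((List.sortedLT_finRange n).pairwise.filter _).sortedLT
  rw [List.ofFn_eq_map (f := F), ← List.prod_map_filter_of_eq_one F (· ∈ Set.range f) _ hF, hl,
    List.map_ofFn]
  rfl

theorem orderedProd_pushParts {A : Type*} [Ring A] {m n : ℕ} (t y : Fin n → A)
    {f : Fin m → Fin n} (hf : StrictMono f) (p : Fin m → ℕ × Bool) :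
    orderedProd t y (pushParts f p) =
      orderedProd (fun q => t (f q)) (fun q => y (f q)) p := by
  unfold orderedProd
  rw [← prod_ofFn_comp_strictMono hf]
  · simp only [pushParts_apply hf.injective]
  · intro h hh
    simp [pushParts_of_notMem p hh, partFactor]

end Pushforward

theorem superRelations_sθ_sx (N : ℕ) :
    SuperRelations (fun i : Fin N => sθ i) (fun i : Fin N => sx i) where
  sq i := by simp [sθ, Algebra.TensorProduct.tmul_mul_tmul]
  anticomm i j := by
    simp only [sθ, Algebra.TensorProduct.tmul_mul_tmul, mul_one]
    rw [eq_neg_of_add_eq_zero_left (ExteriorAlgebra.ι_add_mul_swap _ _), TensorProduct.tmul_neg]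
  comm_odd i j := by
    simp [Commute, SemiconjBy, sθ, sx, Algebra.TensorProduct.tmul_mul_tmul]
  comm_even i j := by
    simp [Commute, SemiconjBy, sx, Algebra.TensorProduct.tmul_mul_tmul, mul_comm]

/-- The monomial of `M_p` at the increasing tuple of indices `φ`. -/
def superMonomial {N n : ℕ} (p : Fin n → ℕ × Bool) (φ : Fin n ↪o Fin N) : SuperAlg N :=
  orderedProd (fun i => sθ (φ i)) (fun i => sx (φ i)) p

theorem Mqs_ofFn {N n : ℕ} (p : Fin n → ℕ × Bool) :
    Mqs (List.ofFn p) (Finset.univ : Finset (Fin N)) =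
      ∑ φ : Fin n ↪o Fin N, superMonomial p φ := by
  unfold Mqs
  symm
  refine Finset.sum_bij (fun φ _ => Finset.univ.map φ.toEmbedding) ?_ ?_ ?_ ?_
  · intro φ _
    simp [Finset.mem_powersetCard]
  · intro φ _ ψ _ h
    have h' := congrArg (fun s : Finset (Fin N) => (s : Set (Fin N))) h
    simp only [Finset.coe_map, Finset.coe_univ, Set.image_univ] at h'
    exact OrderEmbedding.range_inj.1 h'
  · intro S hS
    have hc : S.card = n := by simpa [Finset.mem_powersetCard] using hS
    exact ⟨S.orderEmbOfFin hc, Finset.mem_univ _, S.map_orderEmbOfFin_univ hc⟩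
  · intro φ _
    have hs : (Finset.univ.map φ.toEmbedding).sort (· ≤ ·) = List.ofFn φ := by
      refine (Finset.sortedLT_sort _).eq_of_mem_iff φ.strictMono.sortedLT_ofFn ?_
      simp
    rw [hs]
    unfold superMonomial orderedProd
    congr 1
    refine List.ext_getElem (by simp) ?_
    intro i h₁ h₂
    simp [partFactor]

theorem Mqs_eq_sum_superMonomial {N : ℕ} (α : List (ℕ × Bool)) :
    Mqs α (Finset.univ : Finset (Fin N)) =
      ∑ φ : Fin α.length ↪o Fin N, superMonomial α.get φ := by
  rw [← Mqs_ofFn, List.ofFn_get]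

namespace OverlapShuffle

variable {α β : List (ℕ × Bool)}

theorem r_le (P : OverlapShuffle α β) : P.r ≤ α.length + β.length := by
  have hs : Function.Surjective (Sum.elim P.f P.g) := fun h => by
    rcases P.cover h with ⟨q, hq⟩ | ⟨p, hp⟩
    exacts [⟨Sum.inl q, hq⟩, ⟨Sum.inr p, hp⟩]
  simpa using Fintype.card_le_of_surjective _ hs

instance : Finite (OverlapShuffle α β) := by
  let e : OverlapShuffle α β → Σ r : Fin (α.length + β.length + 1),
      (Fin α.length → Fin r) × (Fin β.length → Fin r) :=
    fun P => ⟨⟨P.r, Nat.lt_succ_of_le P.r_le⟩, P.f, P.g⟩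
  refine Finite.of_injective e ?_
  rintro ⟨r, f, g, _, _, _, _⟩ ⟨r', f', g', _, _, _, _⟩ h
  simp only [e, Sigma.mk.injEq, Fin.mk.injEq] at h
  obtain ⟨rfl, h⟩ := h
  simp only [heq_eq_eq, Prod.mk.injEq] at h
  obtain ⟨rfl, rfl⟩ := h
  rfl

theorem comp_eq_ofFn (P : OverlapShuffle α β) :
    P.comp = List.ofFn fun h => partAdd (pushParts P.f α.get h) (pushParts P.g β.get h) :=
  rfl

theorem sign_eq (P : OverlapShuffle α β) :
    P.sign = (-1) ^ (∑ j, ∑ i, if (pushParts P.g β.get j).2 = true ∧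
      (pushParts P.f α.get i).2 = true ∧ j < i then 1 else 0) := by
  rw [sign, ← Fintype.sum_prod_type', Finset.sum_boole, Nat.cast_id]
  congr 1
  refine Finset.card_bij (fun pq _ => (P.g pq.1, P.f pq.2)) ?_ ?_ ?_
  · rintro ⟨p, q⟩ h
    simpa [pushParts_apply P.g_mono.injective, pushParts_apply P.f_mono.injective] using h
  · rintro ⟨p, q⟩ _ ⟨p', q'⟩ _ h
    simpa [P.g_mono.injective.eq_iff, P.f_mono.injective.eq_iff] using h
  · rintro ⟨j, i⟩ h
    simp only [Finset.mem_filter, Finset.mem_univ, true_and, pushParts_snd] at h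
    obtain ⟨⟨p, rfl, hp⟩, ⟨q, rfl, hq⟩, hlt⟩ := h
    exact ⟨(p, q), by simpa using ⟨hp, hq, hlt⟩, rfl⟩

/-- The increasing tuple of indices at the positions occupied by `α`. -/
def restrictLeft {N : ℕ} (P : OverlapShuffle α β) (φ : Fin P.r ↪o Fin N) :
    Fin α.length ↪o Fin N :=
  OrderEmbedding.ofStrictMono (fun q => φ (P.f q)) (φ.strictMono.comp P.f_mono)

/-- The increasing tuple of indices at the positions occupied by `β`. -/
def restrictRight {N : ℕ} (P : OverlapShuffle α β) (φ : Fin P.r ↪o Fin N) :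
    Fin β.length ↪o Fin N :=
  OrderEmbedding.ofStrictMono (fun p => φ (P.g p)) (φ.strictMono.comp P.g_mono)

theorem sign_smul_superMonomial {N : ℕ} (P : OverlapShuffle α β) (φ : Fin P.r ↪o Fin N) :
    P.sign • superMonomial
        (fun h => partAdd (pushParts P.f α.get h) (pushParts P.g β.get h)) φ =
      superMonomial α.get (P.restrictLeft φ) * superMonomial β.get (P.restrictRight φ) := by
  have h := orderedProd_mul ((superRelations_sθ_sx N).comp φ)
    (pushParts P.f α.get) (pushParts P.g β.get) ?_
  · rw [orderedProd_pushParts _ _ P.f_mono, orderedProd_pushParts _ _ P.g_mono,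
      ← P.sign_eq] at h
    exact h.symm
  · rintro i ⟨hp, hq⟩
    rw [pushParts_snd] at hp hq
    obtain ⟨q, rfl, hq'⟩ := hp
    obtain ⟨p, hpq, hp'⟩ := hq
    exact P.not_both_dotted q p hpq.symm ⟨hq', hp'⟩

theorem range_eq_union {N : ℕ} (P : OverlapShuffle α β) (φ : Fin P.r ↪o Fin N) :
    Set.range φ = Set.range (P.restrictLeft φ) ∪ Set.range (P.restrictRight φ) := by
  ext i
  constructor
  · rintro ⟨h, rfl⟩
    rcases P.cover h with ⟨q, rfl⟩ | ⟨p, rfl⟩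
    exacts [Or.inl ⟨q, rfl⟩, Or.inr ⟨p, rfl⟩]
  · rintro (⟨q, rfl⟩ | ⟨p, rfl⟩)
    exacts [⟨P.f q, rfl⟩, ⟨P.g p, rfl⟩]

theorem restrict_injective (N : ℕ) :
    Function.Injective fun x : (P : OverlapShuffle α β) × (Fin P.r ↪o Fin N) =>
      (x.1.restrictLeft x.2, x.1.restrictRight x.2) := by
  rintro ⟨P, φ⟩ ⟨P', φ'⟩ h
  simp only [Prod.mk.injEq] at h
  have hr : Set.range φ = Set.range φ' := by
    rw [P.range_eq_union, P'.range_eq_union, h.1, h.2]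
  have hf : ∀ q, φ (P.f q) = φ' (P'.f q) := fun q => DFunLike.congr_fun h.1 q
  have hg : ∀ p, φ (P.g p) = φ' (P'.g p) := fun p => DFunLike.congr_fun h.2 p
  have hrr : P.r = P'.r := by
    have h₁ := Set.card_range_of_injective φ.injective
    have h₂ := Set.card_range_of_injective φ'.injective
    simp only [Fintype.card_fin] at h₁ h₂
    rw [← h₁, ← h₂]
    exact Fintype.card_congr (Equiv.setCongr hr)
  obtain ⟨r, f, g, _, _, _, _⟩ := P
  obtain ⟨r', f', g', _, _, _, _⟩ := P'
  obtain rfl : r = r' := hrr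
  obtain rfl : φ = φ' := OrderEmbedding.range_inj.1 hr
  obtain rfl : f = f' := funext fun q => φ.injective (hf q)
  obtain rfl : g = g' := funext fun p => φ.injective (hg p)
  rfl

theorem exists_restrict_eq {N : ℕ} (u : Fin α.length ↪o Fin N) (v : Fin β.length ↪o Fin N)
    (huv : ∀ q p, u q = v p → ¬((α.get q).2 = true ∧ (β.get p).2 = true)) :
    ∃ (P : OverlapShuffle α β) (φ : Fin P.r ↪o Fin N),
      P.restrictLeft φ = u ∧ P.restrictRight φ = v := by
  classical
  let U : Finset (Fin N) := Finset.univ.image u ∪ Finset.univ.image v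
  have hu : ∀ q, u q ∈ U := fun q => by simp [U]
  have hv : ∀ p, v p ∈ U := fun p => by simp [U]
  let e := U.orderIsoOfFin rfl
  let P : OverlapShuffle α β :=
    { r := U.card
      f := fun q => e.symm ⟨u q, hu q⟩
      g := fun p => e.symm ⟨v p, hv p⟩
      f_mono := fun _ _ h => e.symm.strictMono (u.strictMono h)
      g_mono := fun _ _ h => e.symm.strictMono (v.strictMono h)
      cover := fun h => by
        have hU : (e h : Fin N) ∈ U := (e h).2
        simp only [U, Finset.mem_union, Finset.mem_image, Finset.mem_univ, true_and] at hU
        refine hU.imp ?_ ?_ <;> rintro ⟨k, hk⟩ <;>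
          exact ⟨k, e.symm_apply_eq.2 (Subtype.ext hk)⟩
      not_both_dotted := fun q p h =>
        huv q p (congrArg Subtype.val (e.symm.injective h)) }
  refine ⟨P, U.orderEmbOfFin rfl, ?_, ?_⟩
  · ext q
    exact congrArg (fun x : U => ((x : Fin N) : ℕ)) (e.apply_symm_apply ⟨u q, hu q⟩)
  · ext p
    exact congrArg (fun x : U => ((x : Fin N) : ℕ)) (e.apply_symm_apply ⟨v p, hv p⟩)

end OverlapShuffle

theorem superMonomial_mul_eq_zero {N m n : ℕ} {a : Fin m → ℕ × Bool} {b : Fin n → ℕ × Bool}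
    {u : Fin m ↪o Fin N} {v : Fin n ↪o Fin N} {q : Fin m} {p : Fin n} (h : u q = v p)
    (hq : (a q).2 = true) (hp : (b p).2 = true) :
    superMonomial a u * superMonomial b v = 0 := by
  unfold superMonomial
  rw [← orderedProd_pushParts (fun i => sθ i) (fun i => sx i) u.strictMono a,
    ← orderedProd_pushParts (fun i => sθ i) (fun i => sx i) v.strictMono b]
  refine orderedProd_mul_eq_zero (superRelations_sθ_sx N) _ _ (u q) ?_ ?_
  · rwa [pushParts_apply u.injective]
  · rwa [h, pushParts_apply v.injective]

/-!
**Statement 7.** Product rule for monomial quasisymmetric functions in superspace: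
`M_α · M_β = Σ_P sign(P) · M_{Γ(P)}`, the sum running over all `(α,β)`-overlapping
shuffles `P` (a finite collection, the sum being taken as a `finsum`).
-/

theorem Mqs_product_overlapping_shuffles (α β : List (ℕ × Bool))
    (hα : IsDottedComp α) (hβ : IsDottedComp β) (N : ℕ) :
    Mqs α (Finset.univ : Finset (Fin N)) * Mqs β Finset.univ
      = ∑ᶠ P : OverlapShuffle α β,
          P.sign • Mqs P.comp (Finset.univ : Finset (Fin N)) := by
  classical
  have := Fintype.ofFinite (OverlapShuffle α β)
  rw [finsum_eq_sum_of_fintype, Mqs_eq_sum_superMonomial, Mqs_eq_sum_superMonomial,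
    Finset.sum_mul_sum, ← Fintype.sum_prod_type']
  simp only [OverlapShuffle.comp_eq_ofFn, Mqs_ofFn, Finset.smul_sum,
    OverlapShuffle.sign_smul_superMonomial]
  rw [← Fintype.sum_sigma' (fun (P : OverlapShuffle α β) (φ : Fin P.r ↪o Fin N) =>
    superMonomial α.get (P.restrictLeft φ) * superMonomial β.get (P.restrictRight φ))]
  symm
  refine Finset.sum_of_injOn _ (OverlapShuffle.restrict_injective N).injOn
    (fun _ _ => Finset.mem_coe.2 (Finset.mem_univ _)) ?_ (fun _ _ => rfl)
  rintro ⟨u, v⟩ _ huv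
  by_contra hne
  refine huv ?_
  obtain ⟨P, φ, hu, hv⟩ := OverlapShuffle.exists_restrict_eq u v
    fun q p h hd => hne (superMonomial_mul_eq_zero h hd.1 hd.2)
  exact ⟨⟨P, φ⟩, Finset.mem_coe.2 (Finset.mem_univ _), by simp [hu, hv]⟩

end
end

section
/- For every dotted composition α = (α_1,…,α_ℓ) with ℓ ≥ 1 and every N, the following identity (the key identity establishing the antipode formula S(M_α) = (−1)^{ℓ(α)+C(m_α,2)} Σ_{γ ⊵ Rev(α)} M_γ on monomial quasisymmetric functions in superspace) holds in A_N: (−1)^{ℓ + C(m_α,2)} Σ_{γ : γ ⊵ (α_ℓ,…,α_1)} M_γ = Σ_{i=0}^{ℓ−1} Σ_{β : β ⊵ (α_i, α_{i−1}, …, α_1)} (−1)^{i+1+C(m_i,2)} M_β · M_{(α_{i+1},…,α_ℓ)}, where m_α is the fermionic degree of α, m_i is the number of dotted parts among α_1,…,α_i, C(m,2) denotes the binomial coefficient m choose 2, the inner sums run over all dotted compositions γ (resp. β) weakly coarsening the indicated reversed composition, and M_∅ = 1. -/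
open TensorProduct

set_option synthInstance.maxHeartbeats 1000000
set_option maxHeartbeats 1000000

noncomputable section

/-- The fermionic degree of a dotted composition: its number of dotted parts. -/
def fermDeg (α : List (ℕ × Bool)) : ℕ := α.countP (fun p => p.2 = true)

/-- Covering relation of the weak refinement order: `DCMergeCover β α` holds when `α` is
obtained from `β` by replacing two adjacent parts, not both dotted, by a single part whose
value is the sum of their values and which is dotted iff one of the two parts was. -/
def DCMergeCover (β α : List (ℕ × Bool)) : Prop :=
  ∃ (l r : List (ℕ × Bool)) (p q : ℕ × Bool),
    ¬(p.2 = true ∧ q.2 = true) ∧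
    β = l ++ p :: q :: r ∧
    α = l ++ (p.1 + q.1, p.2 || q.2) :: r

/-- The weak refinement order `β ⊴ α` (`β` weakly refines `α`, i.e. `α` weakly
coarsens `β`): reflexive–transitive closure of the merging cover relation. -/
def WeakRefines (β α : List (ℕ × Bool)) : Prop :=
  Relation.ReflTransGen DCMergeCover β α

/-! ### Coarsenings of a dotted composition -/

/-- The compositions obtained from `γ` by merging a new leading part `p` into its first part:
none if `γ` is empty or if both parts are dotted, and exactly one otherwise. -/
def mergeHead (p : ℕ × Bool) : List (ℕ × Bool) → List (List (ℕ × Bool))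
  | [] => []
  | q :: r => if p.2 = true ∧ q.2 = true then [] else [(p.1 + q.1, p.2 || q.2) :: r]

/-- The list of all weak coarsenings of a composition. -/
def coarsenings : List (ℕ × Bool) → List (List (ℕ × Bool))
  | [] => [[]]
  | p :: δ => (coarsenings δ).flatMap fun γ => (p :: γ) :: mergeHead p γ

theorem mem_mergeHead {p : ℕ × Bool} {γ ε : List (ℕ × Bool)} :
    ε ∈ mergeHead p γ ↔ ∃ q r, γ = q :: r ∧ ¬(p.2 = true ∧ q.2 = true) ∧
      ε = (p.1 + q.1, p.2 || q.2) :: r := by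
  cases γ with
  | nil => simp [mergeHead]
  | cons q r =>
    by_cases h : p.2 = true ∧ q.2 = true
    · simp only [mergeHead, if_pos h, List.not_mem_nil, false_iff]
      rintro ⟨q', r', hqr, hn, -⟩
      cases hqr
      exact hn h
    · simp only [mergeHead, if_neg h, List.mem_singleton]
      constructor
      · rintro rfl
        exact ⟨q, r, rfl, h, rfl⟩
      · rintro ⟨q', r', hqr, -, rfl⟩
        cases hqr
        rfl

theorem mem_coarsenings_cons {p : ℕ × Bool} {δ ε : List (ℕ × Bool)} :
    ε ∈ coarsenings (p :: δ) ↔ ∃ γ ∈ coarsenings δ, ε = p :: γ ∨ ε ∈ mergeHead p γ := by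
  simp [coarsenings, List.mem_flatMap]

theorem self_mem_coarsenings (δ : List (ℕ × Bool)) : δ ∈ coarsenings δ := by
  induction δ with
  | nil => simp [coarsenings]
  | cons p δ ih => exact mem_coarsenings_cons.2 ⟨δ, ih, Or.inl rfl⟩

theorem DCMergeCover.cons {γ ε : List (ℕ × Bool)} (h : DCMergeCover γ ε) (p : ℕ × Bool) :
    DCMergeCover (p :: γ) (p :: ε) := by
  obtain ⟨l, r, a, b, hab, rfl, rfl⟩ := h
  exact ⟨p :: l, r, a, b, hab, rfl, rfl⟩

theorem dcMergeCover_of_mem_mergeHead {p : ℕ × Bool} {γ ε : List (ℕ × Bool)}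
    (h : ε ∈ mergeHead p γ) : DCMergeCover (p :: γ) ε := by
  obtain ⟨q, r, rfl, hpq, rfl⟩ := mem_mergeHead.1 h
  exact ⟨[], r, p, q, hpq, rfl, rfl⟩

/-- A cover of `p :: γ` either merges `p` into `γ` or is a cover of `γ` behind `p`. -/
theorem dcMergeCover_cons_iff {p : ℕ × Bool} {γ ε : List (ℕ × Bool)} :
    DCMergeCover (p :: γ) ε ↔ ε ∈ mergeHead p γ ∨ ∃ γ', DCMergeCover γ γ' ∧ ε = p :: γ' := by
  constructor
  · rintro ⟨l, r, a, b, hab, hγ, rfl⟩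
    cases l with
    | nil =>
      simp only [List.nil_append, List.cons.injEq] at hγ
      obtain ⟨rfl, rfl⟩ := hγ
      exact Or.inl (mem_mergeHead.2 ⟨b, r, rfl, hab, rfl⟩)
    | cons c l =>
      simp only [List.cons_append, List.cons.injEq] at hγ
      obtain ⟨rfl, rfl⟩ := hγ
      exact Or.inr ⟨_, ⟨l, r, a, b, hab, rfl, rfl⟩, rfl⟩
  · rintro (h | ⟨γ', h, rfl⟩)
    · exact dcMergeCover_of_mem_mergeHead h
    · exact h.cons p

theorem coarsenings_closed {δ γ ε : List (ℕ × Bool)} (hγ : γ ∈ coarsenings δ)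
    (h : DCMergeCover γ ε) : ε ∈ coarsenings δ := by
  induction δ generalizing γ ε with
  | nil =>
    obtain ⟨l, r, a, b, -, hl, -⟩ := h
    simp [coarsenings, hl] at hγ
  | cons p δ ih =>
    obtain ⟨γ₀, hγ₀, rfl | hm⟩ := mem_coarsenings_cons.1 hγ
    · obtain hm | ⟨γ', h', rfl⟩ := dcMergeCover_cons_iff.1 h
      · exact mem_coarsenings_cons.2 ⟨γ₀, hγ₀, Or.inr hm⟩
      · exact mem_coarsenings_cons.2 ⟨γ', ih hγ₀ h', Or.inl rfl⟩
    · obtain ⟨q, r, rfl, hpq, rfl⟩ := mem_mergeHead.1 hm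
      obtain hm' | ⟨r', h', rfl⟩ := dcMergeCover_cons_iff.1 h
      · obtain ⟨s, t, rfl, hs, rfl⟩ := mem_mergeHead.1 hm'
        have hqs : ¬(q.2 = true ∧ s.2 = true) := by
          rintro ⟨hq, hs'⟩
          exact hs ⟨by simp [hq], hs'⟩
        refine mem_coarsenings_cons.2 ⟨_, ih hγ₀ ⟨[], t, q, s, hqs, rfl, rfl⟩, Or.inr ?_⟩
        refine mem_mergeHead.2 ⟨_, t, rfl, ?_, ?_⟩
        · rcases p with ⟨a, _ | _⟩ <;> rcases q with ⟨b, _ | _⟩ <;> rcases s with ⟨c, _ | _⟩ <;>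
            simp_all
        · simp [add_assoc, Bool.or_assoc]
      · exact mem_coarsenings_cons.2 ⟨q :: r', ih hγ₀ (h'.cons q),
          Or.inr (mem_mergeHead.2 ⟨q, r', rfl, hpq, rfl⟩)⟩

theorem mem_coarsenings_iff {δ γ : List (ℕ × Bool)} :
    γ ∈ coarsenings δ ↔ WeakRefines δ γ := by
  constructor
  · intro h
    induction δ generalizing γ with
    | nil =>
      obtain rfl : γ = [] := by simpa [coarsenings] using h
      exact Relation.ReflTransGen.refl
    | cons p δ ih =>
      obtain ⟨γ₀, hγ₀, hγ⟩ := mem_coarsenings_cons.1 h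
      have hp : WeakRefines (p :: δ) (p :: γ₀) :=
        (ih hγ₀).lift (p :: ·) fun _ _ h => h.cons p
      obtain rfl | hm := hγ
      · exact hp
      · exact hp.tail (dcMergeCover_of_mem_mergeHead hm)
  · intro h
    induction h with
    | refl => exact self_mem_coarsenings δ
    | tail _ h ih => exact coarsenings_closed ih h

theorem IsDottedComp.of_mem_coarsenings {δ γ : List (ℕ × Bool)} (hδ : IsDottedComp δ)
    (hγ : γ ∈ coarsenings δ) : IsDottedComp γ := by
  induction δ generalizing γ with
  | nil =>
    obtain rfl : γ = [] := by simpa [coarsenings] using hγ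
    exact hδ
  | cons p δ ih =>
    have hδ' : IsDottedComp δ := fun q hq => hδ q (List.mem_cons_of_mem _ hq)
    have hp := hδ p List.mem_cons_self
    obtain ⟨γ₀, hγ₀, rfl | hm⟩ := mem_coarsenings_cons.1 hγ
    · intro q hq
      obtain rfl | hq := List.mem_cons.1 hq
      · exact hp
      · exact ih hδ' hγ₀ q hq
    · obtain ⟨q, r, rfl, -, rfl⟩ := mem_mergeHead.1 hm
      intro s hs
      obtain rfl | hs := List.mem_cons.1 hs
      · intro h
        have := hp (by simp_all)
        dsimp only
        omega
      · exact ih hδ' hγ₀ s (List.mem_cons_of_mem _ hs)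

theorem nodup_coarsenings {δ : List (ℕ × Bool)} (hδ : IsDottedComp δ) :
    (coarsenings δ).Nodup := by
  induction δ with
  | nil => simp [coarsenings]
  | cons p δ ih =>
    have hδ' : IsDottedComp δ := fun q hq => hδ q (List.mem_cons_of_mem _ hq)
    have hne : ∀ γ ∈ coarsenings δ, ∀ γ', p :: γ' ∉ mergeHead p γ := by
      intro γ hγ γ' hm
      obtain ⟨q, r, rfl, hpq, he⟩ := mem_mergeHead.1 hm
      have hq := hδ'.of_mem_coarsenings hγ q List.mem_cons_self
      rcases p with ⟨a, _ | _⟩ <;> rcases q with ⟨b, _ | _⟩ <;> simp_all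
    refine List.nodup_flatMap.2 ⟨fun γ hγ => ?_, ?_⟩
    · refine List.nodup_cons.2 ⟨hne γ hγ γ, ?_⟩
      cases γ with
      | nil => simp [mergeHead]
      | cons q r => by_cases h : p.2 = true ∧ q.2 = true <;> simp [mergeHead, h]
    · refine List.Pairwise.imp_of_mem ?_ (ih hδ')
      intro γ γ' hγ hγ' hneq ε hε hε'
      obtain rfl | hε := List.mem_cons.1 hε
      · obtain h | h := List.mem_cons.1 hε'
        · exact hneq (List.cons.inj h).2
        · exact hne γ' hγ' _ h
      · obtain rfl | hε' := List.mem_cons.1 hε'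
        · exact hne γ hγ _ hε
        · obtain ⟨q, r, rfl, hpq, rfl⟩ := mem_mergeHead.1 hε
          obtain ⟨q', r', rfl, hpq', he⟩ := mem_mergeHead.1 hε'
          apply hneq
          rcases p with ⟨a, _ | _⟩ <;> rcases q with ⟨b, _ | _⟩ <;>
            rcases q' with ⟨c, _ | _⟩ <;> simp_all

theorem finsum_weakRefines {A : Type*} [AddCommMonoid A] {δ : List (ℕ × Bool)}
    (hδ : IsDottedComp δ) (f : List (ℕ × Bool) → A) :
    ∑ᶠ (γ : List (ℕ × Bool)) (_ : WeakRefines δ γ), f γ = ((coarsenings δ).map f).sum := by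
  classical
  rw [← List.sum_toFinset f (nodup_coarsenings hδ), ← finsum_mem_coe_finset]
  simp only [List.coe_toFinset, Set.mem_ofPred_eq, mem_coarsenings_iff]

theorem IsDottedComp.reverse_take {α : List (ℕ × Bool)} (hα : IsDottedComp α) (i : ℕ) :
    IsDottedComp (α.take i).reverse :=
  fun p hp => hα p (List.mem_of_mem_take (List.mem_reverse.1 hp))

/-! ### Sums over monotone words in an arbitrary ring -/

section WordSums

variable {ι R : Type*} [Ring R] (y : ι → ℕ × Bool → R)

/-- The sum of `y i₁ α₁ * ⋯ * y iₗ αₗ` over words `i₁, …, iₗ` strictly increasing along `L`. -/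
def strictSum : List ι → List (ℕ × Bool) → R
  | _, [] => 1
  | [], _ :: _ => 0
  | i :: L, p :: α => y i p * strictSum L α + strictSum L (p :: α)

/-- The sum of `y i₁ δ₁ * ⋯ * y iₗ δₗ` over words `i₁, …, iₗ` weakly increasing along `L`. -/
def weakSum : List ι → List (ℕ × Bool) → R
  | _, [] => 1
  | [], _ :: _ => 0
  | i :: L, p :: δ => y i p * weakSum (i :: L) δ + weakSum L (p :: δ)
  termination_by L δ => L.length + δ.length

/-- The sum of `y iₗ δₗ * ⋯ * y i₁ δ₁` over words `i₁, …, iₗ` weakly increasing along `L`. -/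
def weakSumRev : List ι → List (ℕ × Bool) → R
  | _, [] => 1
  | [], _ :: _ => 0
  | i :: L, p :: δ => weakSumRev (i :: L) δ * y i p + weakSumRev L (p :: δ)
  termination_by L δ => L.length + δ.length

/-- The alternating sum, over all ways of transferring leading parts of the second list onto the
first one, of products `weakSumRev * strictSum`. -/
def altSum (L : List ι) : List (ℕ × Bool) → List (ℕ × Bool) → R
  | δ, [] => weakSumRev y L δ
  | δ, p :: α => weakSumRev y L δ * strictSum y L (p :: α) - altSum L (p :: δ) α

@[simp] theorem strictSum_nil (L : List ι) : strictSum y L [] = 1 := by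
  cases L <;> rfl

@[simp] theorem weakSum_nil (L : List ι) : weakSum y L [] = 1 := by
  simp [weakSum]

@[simp] theorem weakSumRev_nil (L : List ι) : weakSumRev y L [] = 1 := by
  simp [weakSumRev]

theorem altSum_cons (i : ι) (L : List ι) (δ α : List (ℕ × Bool)) :
    altSum y (i :: L) δ α =
      altSum y L δ α + (weakSumRev y (i :: L) δ - weakSumRev y L δ) * strictSum y L α := by
  induction α generalizing δ with
  | nil => simp [altSum]
  | cons p α ih =>
    have h : weakSumRev y (i :: L) (p :: δ) =
        weakSumRev y (i :: L) δ * y i p + weakSumRev y L (p :: δ) := by rw [weakSumRev]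
    rw [altSum, altSum, ih, strictSum, h]
    noncomm_ring

theorem altSum_nil_alphabet (p : ℕ × Bool) (δ α : List (ℕ × Bool)) :
    altSum y [] (p :: δ) α = 0 := by
  induction α generalizing p δ with
  | nil => simp [altSum, weakSumRev]
  | cons q α ih => simp [altSum, strictSum, ih]

theorem altSum_nil_left (L : List ι) (p : ℕ × Bool) (α : List (ℕ × Bool)) :
    altSum y L [] (p :: α) = 0 := by
  induction L with
  | nil => simp [altSum, strictSum, altSum_nil_alphabet]
  | cons i L ih => rw [altSum_cons, ih]; simp

theorem altSum_eq_sum (L : List ι) (δ α : List (ℕ × Bool)) :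
    altSum y L δ α = ∑ i ∈ Finset.range (α.length + 1), ((-1 : ℤ) ^ i) •
      (weakSumRev y L ((α.take i).reverse ++ δ) * strictSum y L (α.drop i)) := by
  induction α generalizing δ with
  | nil => simp [altSum]
  | cons p α ih =>
    rw [altSum, ih, List.length_cons, Finset.sum_range_succ' _ (α.length + 1)]
    simp only [List.take_succ_cons, List.drop_succ_cons, List.reverse_cons, List.append_assoc,
      List.singleton_append, pow_succ, mul_neg_one, neg_smul, Finset.sum_neg_distrib,
      List.take_zero, List.drop_zero, List.reverse_nil, List.nil_append, pow_zero, one_smul]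
    abel

theorem sum_map_coarsenings_cons
    (hy : ∀ i p q, y i p * y i q =
      if p.2 = true ∧ q.2 = true then 0 else y i (p.1 + q.1, p.2 || q.2))
    (i : ι) (L : List ι) (p : ℕ × Bool) (δ : List (ℕ × Bool)) :
    ((coarsenings (p :: δ)).map (strictSum y (i :: L))).sum =
      y i p * ((coarsenings δ).map (strictSum y (i :: L))).sum +
        ((coarsenings (p :: δ)).map (strictSum y L)).sum := by
  have key : ∀ γ, (((p :: γ) :: mergeHead p γ).map (strictSum y (i :: L))).sum =
      y i p * strictSum y (i :: L) γ +
        (((p :: γ) :: mergeHead p γ).map (strictSum y L)).sum := by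
    intro γ
    cases γ with
    | nil => simp [mergeHead, strictSum]
    | cons q r =>
      have h := hy i p q
      by_cases hpq : p.2 = true ∧ q.2 = true
      · rw [if_pos hpq] at h
        simp only [mergeHead, if_pos hpq, strictSum, List.map_cons, List.map_nil, List.sum_cons,
          List.sum_nil, mul_add, ← mul_assoc, h]
        noncomm_ring
      · rw [if_neg hpq] at h
        simp only [mergeHead, if_neg hpq, strictSum, List.map_cons, List.map_nil, List.sum_cons,
          List.sum_nil, mul_add, ← mul_assoc, h]
        abel
  rw [coarsenings]
  induction coarsenings δ with
  | nil => simp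
  | cons γ l ih =>
    rw [List.flatMap_cons, List.map_append, List.map_append, List.sum_append, List.sum_append,
      ih, key γ, List.map_cons (l := l), List.sum_cons, mul_add]
    abel

theorem sum_map_coarsenings
    (hy : ∀ i p q, y i p * y i q =
      if p.2 = true ∧ q.2 = true then 0 else y i (p.1 + q.1, p.2 || q.2))
    (L : List ι) (δ : List (ℕ × Bool)) :
    ((coarsenings δ).map (strictSum y L)).sum = weakSum y L δ := by
  induction L generalizing δ with
  | nil =>
    cases δ with
    | nil => simp [coarsenings]
    | cons p δ =>
      rw [weakSum]
      refine List.sum_eq_zero fun z hz => ?_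
      obtain ⟨ε, hε, rfl⟩ := List.mem_map.1 hz
      obtain ⟨γ, -, rfl | hm⟩ := mem_coarsenings_cons.1 hε
      · rfl
      · obtain ⟨q, r, -, -, rfl⟩ := mem_mergeHead.1 hm
        rfl
  | cons i L ihL =>
    induction δ with
    | nil => simp [coarsenings]
    | cons p δ ihδ =>
      rw [sum_map_coarsenings_cons y hy, ihδ, ihL, weakSum]

theorem fermDeg_cons (p : ℕ × Bool) (δ : List (ℕ × Bool)) :
    fermDeg (p :: δ) = fermDeg δ + if p.2 = true then 1 else 0 := by
  simp [fermDeg, List.countP_cons]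

theorem fermDeg_reverse (α : List (ℕ × Bool)) : fermDeg α.reverse = fermDeg α := by
  simp [fermDeg]

theorem weakSum_mul
    (hc : ∀ i j p q, y i p * y j q =
      (if p.2 = true ∧ q.2 = true then (-1 : ℤ) else 1) • (y j q * y i p))
    (L : List ι) (δ : List (ℕ × Bool)) (j : ι) (q : ℕ × Bool) :
    weakSum y L δ * y j q =
      (if q.2 = true then (-1 : ℤ) ^ fermDeg δ else 1) • (y j q * weakSum y L δ) := by
  induction L generalizing δ with
  | nil =>
    cases δ with
    | nil => simp [fermDeg]
    | cons p δ => simp [weakSum]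
  | cons i L ihL =>
    induction δ with
    | nil => simp [fermDeg]
    | cons p δ ihδ =>
      rw [weakSum, add_mul, ihL, mul_assoc, ihδ, mul_smul_comm, ← mul_assoc, hc, mul_add,
        smul_add, smul_mul_assoc, smul_smul, mul_assoc, fermDeg_cons]
      congr 2
      by_cases hp : p.2 = true <;> by_cases hq : q.2 = true <;> simp [hp, hq, pow_succ]

/-- Reversing the order of multiplication in a word with `m` fermions costs `(-1) ^ C(m, 2)`. -/
theorem weakSumRev_eq
    (hc : ∀ i j p q, y i p * y j q =
      (if p.2 = true ∧ q.2 = true then (-1 : ℤ) else 1) • (y j q * y i p))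
    (L : List ι) (δ : List (ℕ × Bool)) :
    weakSumRev y L δ = ((-1 : ℤ) ^ (fermDeg δ).choose 2) • weakSum y L δ := by
  induction L generalizing δ with
  | nil =>
    cases δ with
    | nil => simp [fermDeg]
    | cons p δ => simp [weakSum, weakSumRev]
  | cons i L ihL =>
    induction δ with
    | nil => simp [fermDeg]
    | cons p δ ihδ =>
      rw [weakSum, weakSumRev, ihL, ihδ, smul_mul_assoc, weakSum_mul y hc, smul_smul, smul_add,
        fermDeg_cons]
      congr 2
      by_cases hp : p.2 = true
      · simp [hp, Nat.choose_succ_succ, pow_add, mul_comm]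
      · simp [hp]

end WordSums

/-! ### The superspace variables -/

section Superspace

variable {N : ℕ}

/-- The factor `θ_i^η x_i^a` contributed by a part `(a, η)` placed at position `i`. -/
def superFactor (i : Fin N) (p : ℕ × Bool) : SuperAlg N :=
  (if p.2 then sθ i else 1) * sx i ^ p.1

theorem commute_sx (i : Fin N) (z : SuperAlg N) : Commute (sx i) z := by
  induction z using TensorProduct.induction_on with
  | zero => exact Commute.zero_right _
  | tmul a b =>
    simp only [Commute, SemiconjBy, sx, Algebra.TensorProduct.tmul_mul_tmul, one_mul, mul_one,
      mul_comm]
  | add a b ha hb => exact ha.add_right hb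

theorem sθ_mul_self (i : Fin N) : sθ i * sθ i = (0 : SuperAlg N) := by
  simp [sθ, Algebra.TensorProduct.tmul_mul_tmul]

theorem sθ_mul_comm (i j : Fin N) : sθ i * sθ j = -(sθ j * sθ i : SuperAlg N) := by
  simp only [sθ, Algebra.TensorProduct.tmul_mul_tmul, ← TensorProduct.tmul_neg]
  rw [eq_neg_of_add_eq_zero_left (ExteriorAlgebra.ι_add_mul_swap _ _)]

theorem superFactor_mul (i j : Fin N) (p q : ℕ × Bool) :
    superFactor i p * superFactor j q =
      ((if p.2 then sθ i else 1) * (if q.2 then sθ j else 1)) * (sx i ^ p.1 * sx j ^ q.1) := by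
  simp only [superFactor]
  exact ((commute_sx i _).pow_left _).mul_mul_mul_comm _ _

theorem superFactor_mul_self (i : Fin N) (p q : ℕ × Bool) :
    superFactor i p * superFactor i q =
      if p.2 = true ∧ q.2 = true then 0 else superFactor i (p.1 + q.1, p.2 || q.2) := by
  rw [superFactor_mul, ← pow_add]
  rcases p with ⟨a, _ | _⟩ <;> rcases q with ⟨b, _ | _⟩ <;> simp [superFactor, sθ_mul_self]

theorem superFactor_mul_comm (i j : Fin N) (p q : ℕ × Bool) :
    superFactor i p * superFactor j q =
      (if p.2 = true ∧ q.2 = true then (-1 : ℤ) else 1) •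
        (superFactor j q * superFactor i p) := by
  rw [superFactor_mul, superFactor_mul, ((commute_sx i _).pow_left _).eq]
  rcases p with ⟨a, _ | _⟩ <;> rcases q with ⟨b, _ | _⟩ <;> simp [sθ_mul_comm i j]
  exact neg_mul (sθ j * sθ i : SuperAlg N) _

theorem Mqs_toFinset (α : List (ℕ × Bool)) (L : List (Fin N)) (hL : L.Pairwise (· < ·)) :
    Mqs α L.toFinset = strictSum superFactor L α := by
  induction L generalizing α with
  | nil =>
    cases α with
    | nil => simp [Mqs]
    | cons p α =>
      rw [Mqs, Finset.powersetCard_eq_empty.2 (by simp), Finset.sum_empty, strictSum]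
  | cons i L ih =>
    obtain ⟨hi, hL⟩ := List.pairwise_cons.1 hL
    cases α with
    | nil => simp [Mqs]
    | cons p α =>
      have hnot : i ∉ L.toFinset := fun h => lt_irrefl i (hi i (List.mem_toFinset.1 h))
      rw [strictSum, ← ih _ hL, ← ih _ hL, List.toFinset_cons]
      simp only [Mqs, List.length_cons]
      rw [Finset.powersetCard_succ_insert hnot, Finset.sum_union, add_comm, Finset.sum_image,
        Finset.mul_sum]
      · congr 1
        refine Finset.sum_congr rfl fun S hS => ?_
        have hS' := (Finset.mem_powersetCard.1 hS).1
        rw [Finset.sort_insert _ (fun b hb => (hi b (List.mem_toFinset.1 (hS' hb))).le)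
          (fun h => hnot (hS' h))]
        simp [superFactor]
      · intro S hS T hT h
        have hS' : i ∉ S := fun h => hnot ((Finset.mem_powersetCard.1 hS).1 h)
        have hT' : i ∉ T := fun h => hnot ((Finset.mem_powersetCard.1 hT).1 h)
        rw [← Finset.erase_insert hS', ← Finset.erase_insert hT', h]
      · refine Finset.disjoint_left.2 fun S hS hS' => ?_
        obtain ⟨T, -, rfl⟩ := Finset.mem_image.1 hS'
        exact hnot ((Finset.mem_powersetCard.1 hS).1 (Finset.mem_insert_self i T))

theorem Mqs_univ (α : List (ℕ × Bool)) :
    Mqs α (Finset.univ : Finset (Fin N)) = strictSum superFactor (List.finRange N) α := by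
  rw [← Mqs_toFinset α _ (List.pairwise_lt_finRange N), List.toFinset_finRange]

/-- The sum of `M_γ` over the coarsenings of `δ` is a signed sum over weakly increasing words. -/
theorem sum_map_Mqs_coarsenings (δ : List (ℕ × Bool)) :
    ((coarsenings δ).map fun γ => Mqs γ (Finset.univ : Finset (Fin N))).sum =
      ((-1 : ℤ) ^ (fermDeg δ).choose 2) • weakSumRev superFactor (List.finRange N) δ := by
  simp only [Mqs_univ]
  rw [weakSumRev_eq _ superFactor_mul_comm, smul_smul, ← mul_pow]
  simpa using sum_map_coarsenings _ superFactor_mul_self (List.finRange N) δ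

end Superspace

/-!
**Statement 10.** The key identity establishing the antipode formula
`S(M_α) = (−1)^{ℓ(α) + C(m_α,2)} Σ_{γ ⊵ Rev(α)} M_γ`:
`(−1)^{ℓ + C(m_α,2)} Σ_{γ ⊵ (α_ℓ,…,α_1)} M_γ
   = Σ_{i=0}^{ℓ−1} Σ_{β ⊵ (α_i,…,α_1)} (−1)^{i+1+C(m_i,2)} M_β · M_{(α_{i+1},…,α_ℓ)}`.
-/

theorem Mqs_antipode_identity (α : List (ℕ × Bool)) (hα : IsDottedComp α)
    (hlen : 1 ≤ α.length) (N : ℕ) :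
    ((-1 : ℤ) ^ (α.length + Nat.choose (fermDeg α) 2)) •
        (∑ᶠ (γ : List (ℕ × Bool)) (_ : WeakRefines α.reverse γ),
          Mqs γ (Finset.univ : Finset (Fin N)))
      = ∑ i ∈ Finset.range α.length,
          ∑ᶠ (β : List (ℕ × Bool)) (_ : WeakRefines (α.take i).reverse β),
            ((-1 : ℤ) ^ (i + 1 + Nat.choose (fermDeg (α.take i)) 2)) •
              (Mqs β (Finset.univ : Finset (Fin N)) * Mqs (α.drop i) Finset.univ) := by
  have hsum : ∀ i, ∑ᶠ (β : List (ℕ × Bool)) (_ : WeakRefines (α.take i).reverse β),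
      ((-1 : ℤ) ^ (i + 1 + Nat.choose (fermDeg (α.take i)) 2)) •
        (Mqs β (Finset.univ : Finset (Fin N)) * Mqs (α.drop i) Finset.univ) =
      -(((-1 : ℤ) ^ i) • (weakSumRev superFactor (List.finRange N) ((α.take i).reverse ++ []) *
        strictSum superFactor (List.finRange N) (α.drop i))) := by
    intro i
    have hmap := List.map_map (f := fun β => Mqs β Finset.univ * Mqs (α.drop i) Finset.univ)
      (g := fun z : SuperAlg N => ((-1 : ℤ) ^ (i + 1 + Nat.choose (fermDeg (α.take i)) 2)) • z)
      (l := coarsenings (α.take i).reverse)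
    rw [Function.comp_def] at hmap
    rw [finsum_weakRefines (hα.reverse_take i), ← hmap, ← List.smul_sum, List.sum_map_mul_right,
      sum_map_Mqs_coarsenings, fermDeg_reverse, Mqs_univ, smul_mul_assoc, smul_smul, ← neg_smul,
      List.append_nil]
    congr 1
    rw [pow_add, pow_succ, mul_assoc, ← mul_pow]
    simp
  have hrev : IsDottedComp α.reverse := fun p hp => hα p (List.mem_reverse.1 hp)
  have halt : altSum superFactor (List.finRange N) [] α = 0 := by
    cases α with
    | nil => simp at hlen
    | cons p α => exact altSum_nil_left _ _ _ _
  rw [altSum_eq_sum, Finset.sum_range_succ, List.take_length, List.drop_length, strictSum_nil,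
    mul_one, List.append_nil] at halt
  rw [finsum_weakRefines hrev, sum_map_Mqs_coarsenings, fermDeg_reverse, smul_smul, pow_add,
    mul_assoc, ← mul_pow, Finset.sum_congr rfl fun i _ => hsum i, Finset.sum_neg_distrib]
  simpa using eq_neg_of_add_eq_zero_right halt

end
end

section
/- For every N ≥ 1, the family of monomial quasisymmetric functions in superspace {M_α}, where α ranges over all dotted compositions of length at most N (including the empty composition, with M_∅ = 1), is linearly independent over ℚ in A_N. (This underlies the fact that the M_α form a basis of the ring sQSym of quasisymmetric functions in superspace.) -/
open TensorProduct

set_option synthInstance.maxHeartbeats 1000000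
set_option maxHeartbeats 1000000

noncomputable section

section

variable {N : ℕ}

/-- The exponent of `x` in the monomial attached to a list of indexed parts. -/
def partsExponent (z : List (Fin N × ℕ × Bool)) : Fin N →₀ ℕ :=
  (z.map fun p => Finsupp.single p.1 p.2.1).sum

/-- The list of indices carrying a dotted part. -/
def dottedIndices (z : List (Fin N × ℕ × Bool)) : List (Fin N) :=
  (z.filter fun p => p.2.2).map Prod.fst

/-- The basis of `SuperAlg N` consisting of monomials `x^e θ_T`. -/
def superBasis (N : ℕ) : Module.Basis ((Fin N →₀ ℕ) × Finset (Fin N)) ℚ (SuperAlg N) :=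
  (MvPolynomial.basisMonomials (Fin N) ℚ).tensorProduct (Pi.basisFun ℚ (Fin N)).ExteriorAlgebra

lemma zipWith_prod_eq_tmul (l : List (Fin N)) (α : List (ℕ × Bool)) :
    (List.zipWith (fun i p => (if p.2 then sθ i else 1) * sx i ^ p.1) l α).prod =
      MvPolynomial.monomial (partsExponent (l.zip α)) (1 : ℚ) ⊗ₜ[ℚ]
        ((dottedIndices (l.zip α)).map
          fun i => ExteriorAlgebra.ι ℚ (Pi.single i (1 : ℚ) : Fin N → ℚ)).prod := by
  induction l generalizing α with
  | nil => simp [partsExponent, dottedIndices, Algebra.TensorProduct.one_def]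
  | cons i l ih =>
    cases α with
    | nil => simp [partsExponent, dottedIndices, Algebra.TensorProduct.one_def]
    | cons p α =>
      obtain ⟨a, η⟩ := p
      have hmon : MvPolynomial.monomial
          (Finsupp.single i a + partsExponent (l.zip α)) (1 : ℚ) =
          MvPolynomial.X i ^ a * MvPolynomial.monomial (partsExponent (l.zip α)) 1 := by
        rw [MvPolynomial.X_pow_eq_monomial, MvPolynomial.monomial_mul, one_mul]
      have hexp : partsExponent ((i, a, η) :: l.zip α) =
          Finsupp.single i a + partsExponent (l.zip α) := by
        simp [partsExponent]
      rw [List.zipWith_cons_cons, List.prod_cons, ih, List.zip_cons_cons, hexp, hmon]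
      cases η <;>
        simp [dottedIndices, sx, sθ, Algebra.TensorProduct.tmul_pow,
          Algebra.TensorProduct.tmul_mul_tmul]

lemma exteriorAlgebra_basis_toFinset {l : List (Fin N)} (hl : l.SortedLT) :
    (l.map fun i => ExteriorAlgebra.ι ℚ (Pi.single i (1 : ℚ) : Fin N → ℚ)).prod =
      (Pi.basisFun ℚ (Fin N)).ExteriorAlgebra l.toFinset := by
  have hsort : l.toFinset.sort (· ≤ ·) = l :=
    (List.toFinset_sort _ hl.nodup).2 hl.sortedLE.pairwise
  rw [ExteriorAlgebra.basis_apply_ofCard _ rfl, ExteriorAlgebra.ιMulti_family,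
    ExteriorAlgebra.ιMulti_apply, Set.powersetCard.ofFinEmbEquiv_symm_apply, List.ofFn_eq_map]
  conv_lhs => rw [← hsort, ← Finset.listMap_orderEmbOfFin_finRange l.toFinset rfl, List.map_map]
  simp [Function.comp_def, Set.powersetCard.ofCard]

lemma dottedIndices_sortedLT {z : List (Fin N × ℕ × Bool)}
    (hz : (z.map Prod.fst).SortedLT) : (dottedIndices z).SortedLT :=
  (hz.pairwise.sublist (List.filter_sublist.map _)).sortedLT

lemma zipWith_prod_eq_superBasis {l : List (Fin N)} {α : List (ℕ × Bool)}
    (hz : ((l.zip α).map Prod.fst).SortedLT) :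
    (List.zipWith (fun i p => (if p.2 then sθ i else 1) * sx i ^ p.1) l α).prod =
      superBasis N (partsExponent (l.zip α), (dottedIndices (l.zip α)).toFinset) := by
  rw [zipWith_prod_eq_tmul, exteriorAlgebra_basis_toFinset (dottedIndices_sortedLT hz),
    superBasis, Module.Basis.tensorProduct_apply, MvPolynomial.coe_basisMonomials]

lemma partsExponent_eq_zero {z : List (Fin N × ℕ × Bool)} {i : Fin N}
    (hi : i ∉ z.map Prod.fst) : partsExponent z i = 0 := by
  induction z with
  | nil => simp [partsExponent]
  | cons q z ih =>
    simp only [List.map_cons, List.mem_cons, not_or] at hi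
    have := ih hi.2
    simp_all [partsExponent, eq_comm]

lemma partsExponent_of_mem {z : List (Fin N × ℕ × Bool)} (hz : (z.map Prod.fst).Nodup)
    {p : Fin N × ℕ × Bool} (hp : p ∈ z) : partsExponent z p.1 = p.2.1 := by
  induction z with
  | nil => simp at hp
  | cons q z ih =>
    rw [List.map_cons, List.nodup_cons] at hz
    have hcons : partsExponent (q :: z) p.1 =
        Finsupp.single q.1 q.2.1 p.1 + partsExponent z p.1 := by
      simp [partsExponent]
    rw [hcons]
    rcases List.mem_cons.1 hp with rfl | hp
    · rw [partsExponent_eq_zero hz.1, Finsupp.single_eq_same, add_zero]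
    · have hne : q.1 ≠ p.1 := fun h => hz.1 (h ▸ List.mem_map_of_mem hp)
      rw [ih hz.2 hp, Finsupp.single_apply, if_neg hne, zero_add]

lemma mem_dottedIndices_iff {z : List (Fin N × ℕ × Bool)} (hz : (z.map Prod.fst).Nodup)
    {p : Fin N × ℕ × Bool} (hp : p ∈ z) : p.1 ∈ dottedIndices z ↔ p.2.2 = true := by
  constructor
  · intro h
    obtain ⟨q, hq, hqp⟩ := List.mem_map.1 h
    rw [List.mem_filter] at hq
    rw [← List.inj_on_of_nodup_map hz hq.1 hp hqp]
    exact hq.2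
  · exact fun h => List.mem_map.2 ⟨p, List.mem_filter.2 ⟨hp, h⟩, rfl⟩

lemma mem_map_fst_iff {z : List (Fin N × ℕ × Bool)} (hz : (z.map Prod.fst).Nodup)
    (hpos : ∀ p ∈ z, p.2.2 = false → 1 ≤ p.2.1) (i : Fin N) :
    i ∈ z.map Prod.fst ↔ partsExponent z i ≠ 0 ∨ i ∈ dottedIndices z := by
  constructor
  · intro h
    obtain ⟨p, hp, rfl⟩ := List.mem_map.1 h
    rw [partsExponent_of_mem hz hp, mem_dottedIndices_iff hz hp]
    have := hpos p hp
    cases hη : p.2.2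
    · exact Or.inl (by have := this hη; omega)
    · exact Or.inr rfl
  · rintro (h | h)
    · exact not_imp_comm.1 partsExponent_eq_zero h
    · exact (List.filter_sublist.map _).subset h

lemma eq_map_partsExponent {z : List (Fin N × ℕ × Bool)} (hz : (z.map Prod.fst).Nodup) :
    z = (z.map Prod.fst).map
      fun i => (i, partsExponent z i, decide (i ∈ (dottedIndices z).toFinset)) := by
  rw [List.map_map]
  conv_lhs => rw [← List.map_id z]
  refine List.map_congr_left fun p hp => ?_
  simp [partsExponent_of_mem hz hp, mem_dottedIndices_iff hz hp]

/-- A sorted list of indexed parts is determined by the basis element it represents. -/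
lemma parts_ext {z w : List (Fin N × ℕ × Bool)} (hz : (z.map Prod.fst).SortedLT)
    (hw : (w.map Prod.fst).SortedLT) (hzpos : ∀ p ∈ z, p.2.2 = false → 1 ≤ p.2.1)
    (hwpos : ∀ p ∈ w, p.2.2 = false → 1 ≤ p.2.1)
    (hexp : partsExponent z = partsExponent w)
    (hdot : (dottedIndices z).toFinset = (dottedIndices w).toFinset) : z = w := by
  have hkeys : z.map Prod.fst = w.map Prod.fst := by
    refine hz.eq_of_mem_iff hw fun i => ?_
    rw [mem_map_fst_iff hz.nodup hzpos, mem_map_fst_iff hw.nodup hwpos, hexp,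
      ← List.mem_toFinset, hdot, List.mem_toFinset]
  rw [eq_map_partsExponent hz.nodup, eq_map_partsExponent hw.nodup, hkeys, hexp, hdot]

/-- The list of parts of `α` indexed by the elements of `S` in increasing order. -/
def indexedParts (S : Finset (Fin N)) (α : List (ℕ × Bool)) : List (Fin N × ℕ × Bool) :=
  (S.sort (· ≤ ·)).zip α

/-- The index of the basis element `x^e θ_T` attached to `α` and the set `S` of variables. -/
def partsIndex (S : Finset (Fin N)) (α : List (ℕ × Bool)) : (Fin N →₀ ℕ) × Finset (Fin N) :=
  (partsExponent (indexedParts S α), (dottedIndices (indexedParts S α)).toFinset)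

lemma map_fst_indexedParts {S : Finset (Fin N)} {α : List (ℕ × Bool)} (h : S.card = α.length) :
    (indexedParts S α).map Prod.fst = S.sort (· ≤ ·) :=
  List.map_fst_zip (by simp [h])

lemma map_snd_indexedParts {S : Finset (Fin N)} {α : List (ℕ × Bool)} (h : S.card = α.length) :
    (indexedParts S α).map Prod.snd = α :=
  List.map_snd_zip (by simp [h])

lemma sortedLT_indexedParts {S : Finset (Fin N)} {α : List (ℕ × Bool)} (h : S.card = α.length) :
    ((indexedParts S α).map Prod.fst).SortedLT := by
  rw [map_fst_indexedParts h]
  exact Finset.sortedLT_sort S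

lemma Mqs_eq_sum_superBasis (α : List (ℕ × Bool)) (B : Finset (Fin N)) :
    Mqs α B = ∑ S ∈ B.powersetCard α.length, superBasis N (partsIndex S α) :=
  Finset.sum_congr rfl fun _ hS =>
    zipWith_prod_eq_superBasis (sortedLT_indexedParts (Finset.mem_powersetCard.1 hS).2)

lemma partsIndex_inj {S T : Finset (Fin N)} {α β : List (ℕ × Bool)} (hα : IsDottedComp α)
    (hβ : IsDottedComp β) (hS : S.card = α.length) (hT : T.card = β.length) :
    partsIndex S α = partsIndex T β ↔ S = T ∧ α = β := by
  refine ⟨fun h => ?_, by rintro ⟨rfl, rfl⟩; rfl⟩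
  have hparts : indexedParts S α = indexedParts T β :=
    parts_ext (sortedLT_indexedParts hS) (sortedLT_indexedParts hT)
      (fun p hp => hα _ (List.of_mem_zip hp).2) (fun p hp => hβ _ (List.of_mem_zip hp).2)
      (congrArg Prod.fst h) (congrArg Prod.snd h)
  constructor
  · rw [← Finset.sort_toFinset S (· ≤ ·), ← map_fst_indexedParts hS, hparts,
      map_fst_indexedParts hT, Finset.sort_toFinset]
  · rw [← map_snd_indexedParts hS, hparts, map_snd_indexedParts hT]

lemma superBasis_coord_Mqs {S B : Finset (Fin N)} {α β : List (ℕ × Bool)} (hα : IsDottedComp α)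
    (hβ : IsDottedComp β) (hS : S.card = α.length) (hSB : S ⊆ B) :
    (superBasis N).coord (partsIndex S α) (Mqs β B) = if α = β then 1 else 0 := by
  have hterm : ∀ T ∈ B.powersetCard β.length,
      (superBasis N).coord (partsIndex S α) (superBasis N (partsIndex T β)) =
        if S = T ∧ α = β then 1 else 0 := fun T hT => by
    simp [Module.Basis.coord_apply, Finsupp.single_apply, eq_comm (b := partsIndex S α),
      partsIndex_inj hα hβ hS (Finset.mem_powersetCard.1 hT).2]
  rw [Mqs_eq_sum_superBasis, map_sum, Finset.sum_congr rfl hterm]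
  split_ifs with h
  · subst h
    simp [Finset.mem_powersetCard, hS, hSB]
  · simp [h]

end

/-!
**Statement 11.** For `N ≥ 1`, the family of monomial quasisymmetric functions in
superspace `M_α`, indexed by all dotted compositions `α` of length at most `N`
(including the empty one, with `M_∅ = 1`), is linearly independent over `ℚ` in `A_N`.
-/

theorem Mqs_linearIndependent (N : ℕ) (hN : 1 ≤ N) :
    LinearIndependent ℚ
      (fun α : {α : List (ℕ × Bool) // IsDottedComp α ∧ α.length ≤ N} =>
        Mqs α.1 (Finset.univ : Finset (Fin N))) := by
  have hexists : ∀ α : {α : List (ℕ × Bool) // IsDottedComp α ∧ α.length ≤ N},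
      ∃ S : Finset (Fin N), S.card = α.1.length := fun α => by
    obtain ⟨S, -, hS⟩ := Finset.exists_subset_card_eq
      (s := (Finset.univ : Finset (Fin N))) (by simpa using α.2.2)
    exact ⟨S, hS⟩
  choose S hS using hexists
  refine LinearIndependent.of_pairwise_dual_eq_zero_one _
    (fun α => (superBasis N).coord (partsIndex (S α) α.1)) (fun α β hαβ => ?_) fun α => ?_
  · exact (superBasis_coord_Mqs α.2.1 β.2.1 (hS α) (Finset.subset_univ _)).trans
      (if_neg (Subtype.coe_ne_coe.2 hαβ))
  · rw [superBasis_coord_Mqs α.2.1 α.2.1 (hS α) (Finset.subset_univ _), if_pos rfl]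

end
end
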